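/- For every finite nonempty connected subset S of ℤ² (connected with respect to adjacency at Manhattan distance 1) and for any designated element s₀ ∈ S (e.g., the westernmost point of the southernmost row of S), the 3-fold blow-up 3S = {(3x+i, 3y+j) : (x,y) ∈ S, 0 ≤ i, j ≤ 2} contains a simple path in the grid graph on 3S (points adjacent iff at Manhattan distance 1) both of whose endpoints lie in the 3×3 block {3x₀,…,3x₀+2} × {3y₀,…,3y₀+2} of s₀ = (x₀,y₀), and which contains at least one point of the 3×3 block of every element of S. -/

import Mathlib

namespace ATAM

/-- A tile type: a glue label (a natural number, with `0` the null glue) on each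
of its four sides (north, east, south, west). -/
structure TileType where
  north : ℕ
  east : ℕ
  south : ℕ
  west : ℕ
deriving DecidableEq

/-- An assembly: a partial function from ℤ² to tile types. -/
abbrev Assembly := ℤ × ℤ → Option TileType

/-- The domain of an assembly. -/
def adom (α : Assembly) : Set (ℤ × ℤ) := {p | α p ≠ none}

/-- `α` is a subassembly of `β` (written `α ⊑ β` in the paper). -/
def Subassembly (α β : Assembly) : Prop := ∀ p t, α p = some t → β p = some t

/-- Place tile `t` at position `p`. -/
def place (α : Assembly) (p : ℤ × ℤ) (t : TileType) : Assembly :=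
  fun q => if q = p then some t else α q

/-- Remove the tile (if any) at position `p`. -/
def unplace (α : Assembly) (p : ℤ × ℤ) : Assembly :=
  fun q => if q = p then none else α q

/-- Union of two assemblies (preferring the left one where both are defined). -/
def aunion (α β : Assembly) : Assembly := fun p => (α p).orElse fun _ => β p

/-- Two positions are adjacent iff they are at Manhattan distance 1. -/
def Adjacent (p q : ℤ × ℤ) : Prop := (p.1 - q.1).natAbs + (p.2 - q.2).natAbs = 1

/-- The total strength with which a tile of type `t` placed at (empty) position
`p` would bind to the assembly `α` (glues on abutting sides must match). -/
def attachStrength (str : ℕ → ℕ) (α : Assembly) (p : ℤ × ℤ) (t : TileType) : ℕ :=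
  (match α (p.1, p.2 + 1) with
    | some u => if t.north = u.south then str t.north else 0
    | none => 0) +
  (match α (p.1 + 1, p.2) with
    | some u => if t.east = u.west then str t.east else 0
    | none => 0) +
  (match α (p.1, p.2 - 1) with
    | some u => if t.south = u.north then str t.south else 0
    | none => 0) +
  (match α (p.1 - 1, p.2) with
    | some u => if t.west = u.east then str t.west else 0
    | none => 0)

/-- The strength of the bond between the tiles of `α` at `p` and at `q`
(nonzero only when `q` is one of the four neighbors of `p` and the glue labels
on the abutting sides match). -/
def interactionStrength (str : ℕ → ℕ) (α : Assembly) (p q : ℤ × ℤ) : ℕ :=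
  match α p, α q with
  | some t, some u =>
      if q = (p.1, p.2 + 1) then (if t.north = u.south then str t.north else 0)
      else if q = (p.1 + 1, p.2) then (if t.east = u.west then str t.east else 0)
      else if q = (p.1, p.2 - 1) then (if t.south = u.north then str t.south else 0)
      else if q = (p.1 - 1, p.2) then (if t.west = u.east then str t.west else 0)
      else 0
  | _, _ => 0

/-- The total strength of the cut `(A, B)` of the binding graph of `α`
(each crossing bond is counted exactly once, since `interactionStrength` is
directional and the two matching glues have equal strength). -/
def cutStrength (str : ℕ → ℕ) (α : Assembly) (A B : Finset (ℤ × ℤ)) : ℕ :=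
  ∑ p ∈ A, ∑ q ∈ B, interactionStrength str α p q

/-- `α` is `τ`-stable: every cut of its binding graph has strength at least `τ`. -/
def IsStable (str : ℕ → ℕ) (τ : ℕ) (α : Assembly) : Prop :=
  ∀ A B : Finset (ℤ × ℤ), (A : Set (ℤ × ℤ)) ∪ (B : Set (ℤ × ℤ)) = adom α →
    Disjoint A B → A.Nonempty → B.Nonempty → τ ≤ cutStrength str α A B

/-- A tile assembly system (TAS): a finite tile set, a glue strength function,
a seed assembly and a temperature. -/
structure TAS where
  tiles : Finset TileType
  str : ℕ → ℕ
  seed : Assembly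
  temp : ℕ

/-- Well-formedness of a TAS: the null glue has strength 0, the temperature is
at least 1, and the seed is finite, over the tile set, and `τ`-stable. -/
def WellFormed (𝒯 : TAS) : Prop :=
  𝒯.str 0 = 0 ∧ 1 ≤ 𝒯.temp ∧ (adom 𝒯.seed).Finite ∧
    (∀ p t, 𝒯.seed p = some t → t ∈ 𝒯.tiles) ∧ IsStable 𝒯.str 𝒯.temp 𝒯.seed

/-- A single tile attachment step of `𝒯`. -/
def Step (𝒯 : TAS) (α β : Assembly) : Prop :=
  ∃ p t, t ∈ 𝒯.tiles ∧ α p = none ∧ 𝒯.temp ≤ attachStrength 𝒯.str α p t ∧ β = place α p t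

/-- A (finite or infinite) assembly sequence of `𝒯`, presented as an ℕ-indexed
sequence that starts at the seed and in which each assembly is obtained from the
previous one by a single attachment (or is unchanged, to accommodate finite
sequences). -/
def IsSeq (𝒯 : TAS) (f : ℕ → Assembly) : Prop :=
  f 0 = 𝒯.seed ∧ ∀ n, Step 𝒯 (f n) (f (n + 1)) ∨ f (n + 1) = f n

/-- `α` is producible in `𝒯`: it is the result (limit) of an assembly sequence. -/
def Producible (𝒯 : TAS) (α : Assembly) : Prop :=
  ∃ f : ℕ → Assembly, IsSeq 𝒯 f ∧ ∀ p t, α p = some t ↔ ∃ n, f n p = some t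

/-- `β` is producible from `α` by the attachment of zero or more tiles
(`α →^𝒯 β`). -/
def ProducibleFrom (𝒯 : TAS) (α β : Assembly) : Prop :=
  Relation.ReflTransGen (Step 𝒯) α β

/-- `α` is terminal: no tile can attach to it. -/
def Terminal (𝒯 : TAS) (α : Assembly) : Prop :=
  ∀ p t, t ∈ 𝒯.tiles → α p = none → attachStrength 𝒯.str α p t < 𝒯.temp

/-- `𝒯` self-assembles the shape `S`: every producible terminal assembly has
domain `S`, and there is at least one producible terminal assembly. -/
def SelfAssembles (𝒯 : TAS) (S : Set (ℤ × ℤ)) : Prop :=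
  (∀ α, Producible 𝒯 α → Terminal 𝒯 α → adom α = S) ∧
    ∃ α, Producible 𝒯 α ∧ Terminal 𝒯 α

/-- `S ⊆ ℤ²` is connected w.r.t. adjacency at Manhattan distance 1. -/
def ConnectedIn (S : Set (ℤ × ℤ)) : Prop :=
  ∀ p ∈ S, ∀ q ∈ S, Relation.ReflTransGen (fun a b => a ∈ S ∧ b ∈ S ∧ Adjacent a b) p q

end ATAM
namespace ATAM

/-- The 3×3 block of a point `p ∈ ℤ²` in the 3-fold blow-up. -/
def block3 (p : ℤ × ℤ) : Set (ℤ × ℤ) :=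
  {q | ∃ i j : ℕ, i ≤ 2 ∧ j ≤ 2 ∧ q = (3 * p.1 + (i : ℤ), 3 * p.2 + (j : ℤ))}

/-- The 3-fold blow-up of a set `S ⊆ ℤ²`. -/
def blowUp3 (S : Set (ℤ × ℤ)) : Set (ℤ × ℤ) := ⋃ p ∈ S, block3 p

/-- The four axis directions. -/
inductive Dir
  | east | north | west | south

namespace Dir

/-- The unit vector of a direction. -/
def vec : Dir → ℤ × ℤ
  | east => (1, 0)
  | north => (0, 1)
  | west => (-1, 0)
  | south => (0, -1)

/-- The opposite direction. -/
def opp : Dir → Dir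
  | east => west
  | north => south
  | west => east
  | south => north

/-- The offset at which a counterclockwise tour of a block leaves towards the neighbour in
the given direction. -/
def exit : Dir → ℤ × ℤ
  | east => (2, 0)
  | north => (1, 2)
  | west => (0, 1)
  | south => (0, 0)

/-- The offset at which a counterclockwise tour of a block comes in from the neighbour in
the given direction; it follows `exit` on the boundary of the block. -/
def entry : Dir → ℤ × ℤ
  | east => (2, 1)
  | north => (0, 2)
  | west => (0, 0)
  | south => (1, 0)

end Dir

/-- The boundary of a 3×3 block, counterclockwise from the top right corner. -/
def ring : List (ℤ × ℤ) :=
  [(2, 2), (1, 2), (0, 2), (0, 1), (0, 0), (1, 0), (2, 0), (2, 1)]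

/-- The boundary of a 3×3 block, counterclockwise from `d.entry` to `d.exit`. -/
def Dir.ring : Dir → List (ℤ × ℤ)
  | east => ATAM.ring.rotate 7
  | north => ATAM.ring.rotate 2
  | west => ATAM.ring.rotate 4
  | south => ATAM.ring.rotate 5

/-- The point at offset `o` in the block of `p`. -/
def cell (p o : ℤ × ℤ) : ℤ × ℤ := (3 * p.1 + o.1, 3 * p.2 + o.2)

theorem Adjacent.exists_dir {p q : ℤ × ℤ} (h : Adjacent p q) : ∃ d : Dir, q = p + d.vec := by
  obtain ⟨a, b⟩ := p
  obtain ⟨c, e⟩ := q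
  simp only [Adjacent] at h
  have : (c = a + 1 ∧ e = b) ∨ (c = a ∧ e = b + 1) ∨ (c = a - 1 ∧ e = b) ∨
      (c = a ∧ e = b - 1) := by omega
  rcases this with ⟨rfl, rfl⟩ | ⟨rfl, rfl⟩ | ⟨rfl, rfl⟩ | ⟨rfl, rfl⟩
  · exact ⟨.east, by simp [Dir.vec]⟩
  · exact ⟨.north, by simp [Dir.vec]⟩
  · exact ⟨.west, by simp [Dir.vec, sub_eq_add_neg]⟩
  · exact ⟨.south, by simp [Dir.vec, sub_eq_add_neg]⟩

theorem cell_injective (p : ℤ × ℤ) : Function.Injective (cell p) := by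
  rintro ⟨a, b⟩ ⟨c, d⟩ h
  simpa [cell] using h

theorem Adjacent.cell {o o' : ℤ × ℤ} (h : Adjacent o o') (p : ℤ × ℤ) :
    Adjacent (cell p o) (cell p o') := by
  simp only [Adjacent, ATAM.cell] at h ⊢
  omega

theorem cell_mem_block3 {o : ℤ × ℤ} (h : o ∈ ring) (p : ℤ × ℤ) : cell p o ∈ block3 p := by
  have ho : 0 ≤ o.1 ∧ o.1 ≤ 2 ∧ 0 ≤ o.2 ∧ o.2 ≤ 2 := by
    revert o
    decide
  refine ⟨o.1.toNat, o.2.toNat, by omega, by omega, ?_⟩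
  simp only [cell, Prod.mk.injEq]
  omega

theorem eq_of_mem_block3 {p p' q : ℤ × ℤ} (h : q ∈ block3 p) (h' : q ∈ block3 p') :
    p = p' := by
  obtain ⟨i, j, hi, hj, rfl⟩ := h
  obtain ⟨k, l, hk, hl, h⟩ := h'
  simp only [Prod.mk.injEq] at h
  ext <;> omega

theorem isChain_ring : ring.IsChain Adjacent := by
  unfold ring Adjacent
  decide

namespace Dir

theorem perm_ring (d : Dir) : d.ring.Perm ATAM.ring := by
  cases d <;> decide

theorem isChain_ring (d : Dir) : d.ring.IsChain Adjacent := by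
  unfold Adjacent
  cases d <;> decide

theorem head?_ring (d : Dir) : d.ring.head? = some d.entry := by
  cases d <;> rfl

theorem getLast?_ring (d : Dir) : d.ring.getLast? = some d.exit := by
  cases d <;> rfl

theorem exit_mem_ring (d : Dir) : d.exit ∈ ATAM.ring := by
  cases d <;> decide

theorem gate_infix_ring (d : Dir) : [d.exit, d.entry] <:+: ATAM.ring := by
  cases d <;> decide

theorem gate_infix_dir_ring {d e : Dir} (h : e ≠ d) : [e.exit, e.entry] <:+: d.ring := by
  cases d <;> cases e <;> first | exact absurd rfl h | decide

theorem exit_injective : Function.Injective exit := by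
  intro d e h
  cases d <;> cases e <;> first | rfl | exact absurd h (by decide)

theorem vec_add_vec_opp (d : Dir) : d.vec + d.opp.vec = 0 := by
  cases d <;> rfl

theorem adjacent_exit (d : Dir) (p : ℤ × ℤ) :
    Adjacent (cell p d.exit) (cell (p + d.vec) d.opp.entry) := by
  cases d <;> simp only [Adjacent, cell, exit, entry, opp, vec, Prod.fst_add, Prod.snd_add] <;>
    omega

theorem adjacent_entry (d : Dir) (p : ℤ × ℤ) :
    Adjacent (cell (p + d.vec) d.opp.exit) (cell p d.entry) := by
  cases d <;> simp only [Adjacent, cell, exit, entry, opp, vec, Prod.fst_add, Prod.snd_add] <;>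
    omega

end Dir

theorem mem_block3_of_mem_map {p q : ℤ × ℤ} {d : Dir} (h : q ∈ d.ring.map (cell p)) :
    q ∈ block3 p := by
  obtain ⟨o, ho, rfl⟩ := List.mem_map.1 h
  exact cell_mem_block3 (d.perm_ring.mem_iff.1 ho) p

theorem pair_infix_insert {α : Type*} {x y a b : α} {l₁ l₂ : List α} (r : List α)
    (h : [x, y] <:+: l₁ ++ a :: b :: l₂) (hne : x ≠ a ∨ y ≠ b) :
    [x, y] <:+: l₁ ++ a :: (r ++ b :: l₂) := by
  induction l₁ with
  | nil =>
    rw [List.nil_append, List.infix_cons_iff] at h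
    rcases h with h | h
    · simp only [List.cons_prefix_cons] at h
      rcases hne with hne | hne
      · exact absurd h.1 hne
      · exact absurd h.2.1 hne
    · exact h.trans (List.infix_cons (List.suffix_append r _).isInfix)
  | cons c l ih =>
    rw [List.cons_append, List.infix_cons_iff] at h ⊢
    rcases h with h | h
    · left
      cases l <;> simpa [List.cons_prefix_cons] using h
    · exact .inr (ih h)

/-- `L` is a simple path in the blow-up of `T` that starts and ends in the block of `s₀`, visits
every block, and uses the gate edge of every side of a block that faces the complement of `T`. -/
structure IsTour (s₀ : ℤ × ℤ) (T : Set (ℤ × ℤ)) (L : List (ℤ × ℤ)) : Prop where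
  nodup : L.Nodup
  isChain : L.IsChain Adjacent
  subset : ∀ q ∈ L, q ∈ blowUp3 T
  head : ∃ a, L.head? = some a ∧ a ∈ block3 s₀
  last : ∃ b, L.getLast? = some b ∧ b ∈ block3 s₀
  visits : ∀ p ∈ T, ∃ q ∈ L, q ∈ block3 p
  gates : ∀ p ∈ T, ∀ d : Dir, p + d.vec ∉ T → [cell p d.exit, cell p d.entry] <:+: L

theorem isTour_singleton (s₀ : ℤ × ℤ) : IsTour s₀ {s₀} (ring.map (cell s₀)) where
  nodup := List.Nodup.map (cell_injective s₀) (by decide)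
  isChain := List.isChain_map_of_isChain _ (fun _ _ h => h.cell s₀) isChain_ring
  subset q hq := by
    obtain ⟨o, ho, rfl⟩ := List.mem_map.1 hq
    exact Set.mem_biUnion rfl (cell_mem_block3 ho s₀)
  head := ⟨_, rfl, cell_mem_block3 (by decide) s₀⟩
  last := ⟨_, rfl, cell_mem_block3 (o := (2, 1)) (by decide) s₀⟩
  visits p hp := ⟨cell p (2, 2), by rw [hp]; exact List.mem_map_of_mem (by decide),
    cell_mem_block3 (by decide) p⟩
  gates p hp d _ := by
    rw [Set.mem_singleton_iff.1 hp]
    exact d.gate_infix_ring.map (cell s₀)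

theorem IsTour.insert {s₀ p : ℤ × ℤ} {T : Set (ℤ × ℤ)} {L : List (ℤ × ℤ)} (h : IsTour s₀ T L)
    (hp : p ∈ T) (d : Dir) (hd : p + d.vec ∉ T) : ∃ L', IsTour s₀ (insert (p + d.vec) T) L' := by
  obtain ⟨l₁, l₂, hL⟩ := h.gates p hp d hd
  replace hL : L = l₁ ++ cell p d.exit :: cell p d.entry :: l₂ := by simp [← hL]
  set q := p + d.vec with hq
  set r := d.opp.ring.map (cell q) with hr
  have hperm : (l₁ ++ cell p d.exit :: (r ++ cell p d.entry :: l₂)).Perm (r ++ L) := by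
    rw [hL, List.perm_iff_count]
    intro a
    simp only [List.count_append, List.count_cons]
    omega
  have hmem : ∀ x, x ∈ l₁ ++ cell p d.exit :: (r ++ cell p d.entry :: l₂) ↔ x ∈ r ∨ x ∈ L := by
    intro x
    rw [hperm.mem_iff, List.mem_append]
  have hhead : r.head? = some (cell q d.opp.entry) := by
    simp [hr, Dir.head?_ring]
  have hlast : r.getLast? = some (cell q d.opp.exit) := by
    simp [hr, Dir.getLast?_ring]
  refine ⟨l₁ ++ cell p d.exit :: (r ++ cell p d.entry :: l₂), ?_, ?_, ?_, ?_, ?_, ?_, ?_⟩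
  · rw [hperm.nodup_iff, List.nodup_append']
    refine ⟨(d.opp.perm_ring.nodup_iff.2 (by decide)).map (cell_injective q), h.nodup, ?_⟩
    intro x hx hxL
    obtain ⟨t, ht, hxt⟩ := Set.mem_iUnion₂.1 (h.subset x hxL)
    exact hd (eq_of_mem_block3 hxt (mem_block3_of_mem_map hx) ▸ ht)
  · have hc := h.isChain
    have hrc : r.IsChain Adjacent :=
      List.isChain_map_of_isChain _ (fun _ _ h => h.cell q) d.opp.isChain_ring
    rw [hL, List.isChain_append] at hc
    obtain ⟨h₁, h₂, h₃⟩ := hc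
    rw [List.isChain_cons_cons] at h₂
    rw [List.isChain_append, List.isChain_cons, List.isChain_append]
    refine ⟨h₁, ⟨?_, hrc, h₂.2, ?_⟩, h₃⟩
    · intro y hy
      rw [List.head?_append, hhead] at hy
      obtain rfl : cell q d.opp.entry = y := by simpa using hy
      exact d.adjacent_exit p
    · intro x hx y hy
      rw [hlast] at hx
      obtain rfl : cell q d.opp.exit = x := by simpa using hx
      obtain rfl : cell p d.entry = y := by simpa using hy
      exact d.adjacent_entry p
  · intro x hx
    rcases (hmem x).1 hx with hx | hx
    · exact Set.mem_biUnion (Set.mem_insert _ _) (mem_block3_of_mem_map hx)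
    · exact Set.biUnion_subset_biUnion_left (Set.subset_insert _ _) (h.subset x hx)
  · simpa [hL, List.head?_append] using h.head
  · simpa [hL, List.getLast?_append, List.getLast?_cons] using h.last
  · rintro t (rfl | ht)
    · have hx : cell q d.opp.exit ∈ r := List.mem_of_getLast? hlast
      exact ⟨_, (hmem _).2 (.inl hx), mem_block3_of_mem_map hx⟩
    · obtain ⟨x, hx, hxt⟩ := h.visits t ht
      exact ⟨x, (hmem x).2 (.inr hx), hxt⟩
  · intro t ht e hte
    rw [Set.mem_insert_iff, not_or] at hte
    rcases ht with rfl | ht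
    · have he : e ≠ d.opp := by
        rintro rfl
        rw [hq, add_assoc, d.vec_add_vec_opp, add_zero] at hte
        exact hte.2 hp
      refine ((Dir.gate_infix_dir_ring he).map (cell q)).trans ?_
      exact ⟨l₁ ++ [cell p d.exit], cell p d.entry :: l₂, by simp [hr]⟩
    · refine pair_infix_insert r (hL ▸ h.gates t ht e hte.2) (.inl fun heq => ?_)
      have htp : t = p := eq_of_mem_block3 (cell_mem_block3 e.exit_mem_ring t)
        (heq ▸ cell_mem_block3 d.exit_mem_ring p)
      subst htp
      rw [Dir.exit_injective (cell_injective t heq)] at hte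
      exact hte.1 rfl

theorem exists_isTour {S : Set (ℤ × ℤ)} (hfin : S.Finite) (hconn : ConnectedIn S) {s₀ : ℤ × ℤ}
    (hs₀ : s₀ ∈ S) : ∃ L, IsTour s₀ S L := by
  have hF : {T | T ⊆ S ∧ s₀ ∈ T ∧ ∃ L, IsTour s₀ T L}.Finite :=
    hfin.finite_subsets.subset fun T hT => hT.1
  obtain ⟨T, ⟨hTS, hsT, L, hL⟩, hmax⟩ := hF.exists_maximal
    ⟨{s₀}, Set.singleton_subset_iff.2 hs₀, rfl, _, isTour_singleton s₀⟩
  suffices hST : S ⊆ T from ⟨L, hTS.antisymm hST ▸ hL⟩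
  intro q hq
  induction hconn s₀ hs₀ q hq with
  | refl => exact hsT
  | @tail b c _ hbc ih =>
    obtain ⟨hb, hc, hadj⟩ := hbc
    obtain ⟨d, rfl⟩ := hadj.exists_dir
    by_contra hcT
    exact hcT (hmax ⟨Set.insert_subset hc hTS, Set.mem_insert_of_mem _ hsT,
      hL.insert (ih hb) d hcT⟩ (Set.subset_insert _ _) (Set.mem_insert _ _))

/-- **Scale-3 connectivity lemma**: for every finite nonempty connected
`S ⊆ ℤ²` and designated `s₀ ∈ S`, the 3-fold blow-up of `S` contains a simple
path whose endpoints both lie in the 3×3 block of `s₀` and which meets the 3×3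
block of every element of `S`. -/
theorem scale3_dependence_path (S : Set (ℤ × ℤ)) (hfin : S.Finite)
    (hne : S.Nonempty) (hconn : ConnectedIn S) (s₀ : ℤ × ℤ) (hs₀ : s₀ ∈ S) :
    ∃ L : List (ℤ × ℤ), L ≠ [] ∧ L.Nodup ∧ List.Chain' Adjacent L ∧
      (∀ q ∈ L, q ∈ blowUp3 S) ∧
      (∃ a, L.head? = some a ∧ a ∈ block3 s₀) ∧
      (∃ b, L.getLast? = some b ∧ b ∈ block3 s₀) ∧
      (∀ p ∈ S, ∃ q ∈ L, q ∈ block3 p) := by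
  obtain ⟨L, hL⟩ := exists_isTour hfin hconn hs₀
  refine ⟨L, ?_, hL.nodup, hL.isChain, hL.subset, hL.head, hL.last, hL.visits⟩
  rintro rfl
  simpa using hL.head

end ATAM
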